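/- Fix integers 1 ≤ r ≤ n and work over ℂ[q]. Set c := (−1)^{r−1}·q. Let P ∈ ℂ[q][x₁,…,x_r] be symmetric in x₁,…,x_r and suppose P·Δ lies in the ideal I_P(c) generated by x₁^n − c, …, x_r^n − c. Then P lies in the ideal I_G(c) of ℂ[q][x₁,…,x_r] generated by h_{n−r+1}, …, h_{n−1}, h_n − c. -/

import Mathlib

open Finset MvPolynomial

/-- The complete homogeneous symmetric polynomial of degree `k` in the variables
`x₁, …, x_r`: the sum of all monomials of total degree `k`. -/
noncomputable def hsymm (R : Type*) [CommRing R] (r k : ℕ) : MvPolynomial (Fin r) R :=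
  ∑ d ∈ (Fintype.piFinset fun _ : Fin r => Finset.range (k + 1)).filter
      (fun d => ∑ i, d i = k),
    ∏ i, X i ^ d i

/-- The Vandermonde determinant `Δ = ∏_{1 ≤ i < j ≤ r} (xᵢ - xⱼ)`. -/
noncomputable def vander (R : Type*) [CommRing R] (r : ℕ) : MvPolynomial (Fin r) R :=
  ∏ p ∈ Finset.univ.filter (fun p : Fin r × Fin r => p.1 < p.2), (X p.1 - X p.2)

/-- The ideal `I_P(c) = ⟨x₁ⁿ - c, …, x_rⁿ - c⟩` of `R[x₁,…,x_r]`. -/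
noncomputable def IP (R : Type*) [CommRing R] (r n : ℕ) (c : R) :
    Ideal (MvPolynomial (Fin r) R) :=
  Ideal.span (Set.range fun i : Fin r => X i ^ n - C c)

/-- The ideal `I_G(c) = ⟨h_{n-r+1}, …, h_{n-1}, h_n - c⟩` of `R[x₁,…,x_r]`. -/
noncomputable def IG (R : Type*) [CommRing R] (r n : ℕ) (c : R) :
    Ideal (MvPolynomial (Fin r) R) :=
  Ideal.span ((fun k => hsymm R r k) '' Set.Icc (n - r + 1) (n - 1) ∪ {hsymm R r n - C c})

open Polynomial in
/-- top coefficient of the remainder modulo `∏ (t - x_i)`, in degree `s`. -/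
noncomputable def topL {S : Type*} [CommRing S] (f : (Polynomial S)) (s : ℕ) : (Polynomial S) →ₗ[S] S :=
  (Polynomial.lcoeff S s).comp (Polynomial.modByMonicHom f)

open Polynomial in
noncomputable def ff {S : Type*} [CommRing S] {s : ℕ} (x : Fin s → S) : (Polynomial S) :=
  ∏ i, (Polynomial.X - Polynomial.C (x i))

open Polynomial in
lemma ff_monic {S : Type*} [CommRing S] {s : ℕ} (x : Fin s → S) : (ff x).Monic :=
  Polynomial.monic_prod_of_monic _ _ fun i _ => Polynomial.monic_X_sub_C _

open Polynomial in
lemma ff_natDegree {S : Type*} [CommRing S] [Nontrivial S] {s : ℕ} (x : Fin s → S) :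
    (ff x).natDegree = s := by
  unfold ff
  simp

open Polynomial in
lemma topL_apply {S : Type*} [CommRing S] (f p : (Polynomial S)) (s : ℕ) :
    topL f s p = (p %ₘ f).coeff s := rfl

open Polynomial in
lemma topL_of_lt {S : Type*} [CommRing S] (f p : (Polynomial S)) (s : ℕ) (hf : f.Monic)
    (h : p.degree < f.degree) : topL f s p = p.coeff s := by
  nontriviality S
  rw [topL_apply, (Polynomial.modByMonic_eq_self_iff hf).2 h]

open Polynomial in
lemma topL_mul {S : Type*} [CommRing S] (f p : (Polynomial S)) (s : ℕ) (hf : f.Monic) :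
    topL f s (f * p) = 0 := by
  rw [topL_apply, (Polynomial.modByMonic_eq_zero_iff_dvd hf).2 (dvd_mul_right _ _)]; simp

open Polynomial in
lemma topL_succ {S : Type*} [CommRing S] [Nontrivial S] (g p : (Polynomial S)) (a : S) (s : ℕ)
    (hg : g.Monic) (hd : g.natDegree = s + 1) :
    topL ((Polynomial.X - Polynomial.C a) * g) (s + 1) ((Polynomial.X - Polynomial.C a) * p) = topL g s p := by
  have h1 : (Polynomial.X - Polynomial.C a) * p = ((Polynomial.X - Polynomial.C a) * g) * (p /ₘ g) + (Polynomial.X - Polynomial.C a) * (p %ₘ g) := by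
    conv_lhs => rw [← Polynomial.modByMonic_add_div p g]
    ring
  have hm : ((Polynomial.X - Polynomial.C a) * g).Monic := (monic_X_sub_C a).mul hg
  have hlt : (p %ₘ g).degree < g.degree := degree_modByMonic_lt p hg
  rw [h1, map_add, topL_mul _ _ _ hm, zero_add, topL_of_lt _ _ _ hm, topL_apply]
  · have : (p %ₘ g).coeff (s + 1) = 0 := by
      apply coeff_eq_zero_of_degree_lt
      rw [degree_eq_natDegree hg.ne_zero, hd] at hlt
      exact hlt
    rw [sub_mul, Polynomial.coeff_sub, Polynomial.coeff_X_mul, Polynomial.coeff_C_mul, this]; simp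
  · by_cases h0 : p %ₘ g = 0
    · rw [h0, mul_zero, degree_zero, bot_lt_iff_ne_bot]
      exact mt degree_eq_bot.1 hm.ne_zero
    · rw [degree_eq_natDegree hg.ne_zero, degree_eq_natDegree h0] at hlt
      rw [degree_eq_natDegree hm.ne_zero, (monic_X_sub_C a).natDegree_mul hg]
      rw [(monic_X_sub_C a).degree_mul_comm, (monic_X_sub_C a).degree_mul, degree_X_sub_C,
        degree_eq_natDegree h0, natDegree_X_sub_C]
      have : (p %ₘ g).natDegree < g.natDegree := by exact_mod_cast hlt
      exact_mod_cast (by omega : (p %ₘ g).natDegree + 1 < 1 + g.natDegree)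

/-- Generating series of complete homogeneous polynomials. -/
noncomputable def HH {S : Type*} [CommRing S] {s : ℕ} (x : Fin s → S) : PowerSeries S :=
  ∏ i, PowerSeries.mk fun k => x i ^ k

lemma geom_mul {S : Type*} [CommRing S] (a : S) :
    (1 - PowerSeries.C a * PowerSeries.X) * (PowerSeries.mk fun k => a ^ k) = 1 := by
  ext k
  rcases k with _ | k
  · simp [sub_mul, mul_assoc]
  · simp [sub_mul, mul_assoc, PowerSeries.coeff_succ_X_mul, PowerSeries.coeff_one, pow_succ']

lemma HH_zero {S : Type*} [CommRing S] {s : ℕ} (x : Fin s → S) :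
    PowerSeries.coeff 0 (HH x) = 1 := by
  simp only [HH, PowerSeries.coeff_zero_eq_constantCoeff, map_prod]
  exact Finset.prod_eq_one fun i _ => by simp [← PowerSeries.coeff_zero_eq_constantCoeff_apply]

lemma HH_succ {S : Type*} [CommRing S] {s : ℕ} (x : Fin (s + 1) → S) (k : ℕ) :
    PowerSeries.coeff (k + 1) (HH x) = x 0 * PowerSeries.coeff k (HH x) +
      PowerSeries.coeff (k + 1) (HH fun i => x (Fin.succ i)) := by
  have h : (1 - PowerSeries.C (x 0) * PowerSeries.X) * HH x = HH fun i => x (Fin.succ i) := by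
    unfold HH
    rw [Fin.prod_univ_succ, ← mul_assoc, geom_mul, one_mul]
  rw [← h, sub_mul, one_mul, map_sub, mul_assoc, PowerSeries.coeff_C_mul,
    PowerSeries.coeff_succ_X_mul]
  ring

open Polynomial in
lemma topL_pow_lt {S : Type*} [CommRing S] [Nontrivial S] {s : ℕ} (x : Fin (s + 1) → S) (m : ℕ)
    (hm : m ≤ s) : topL (ff x) s (Polynomial.X ^ m) = if m = s then 1 else 0 := by
  rw [topL_of_lt _ _ _ (ff_monic x), Polynomial.coeff_X_pow]
  · simp [eq_comm]
  · rw [degree_eq_natDegree (ff_monic x).ne_zero, ff_natDegree, degree_X_pow]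
    exact_mod_cast (by omega : m < s + 1)

open Polynomial in
lemma topL_pow {S : Type*} [CommRing S] [Nontrivial S] {s : ℕ} : ∀ (x : Fin (s + 1) → S) (k : ℕ),
    topL (ff x) s (Polynomial.X ^ (k + s)) = PowerSeries.coeff k (HH x) := by
  induction s with
  | zero =>
    intro x k
    simp [ff, HH, topL_apply, modByMonic_X_sub_C_eq_C_eval]
    rw [← map_pow, Polynomial.coeff_C_zero]
  | succ s ih =>
    intro x k
    have hff : ff x = (Polynomial.X - Polynomial.C (x 0)) * ff (fun i => x (Fin.succ i)) := by
      unfold ff; rw [Fin.prod_univ_succ]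
    induction k with
    | zero => rw [topL_pow_lt x _ (by omega), HH_zero]; simp
    | succ k ihk =>
      rw [HH_succ, ← ihk, ← ih]
      have h1 : (Polynomial.X : (Polynomial S)) ^ (k + 1 + (s + 1)) = x 0 • Polynomial.X ^ (k + (s + 1)) +
          (Polynomial.X - Polynomial.C (x 0)) * Polynomial.X ^ (k + 1 + s) := by
        rw [Polynomial.smul_eq_C_mul]; ring
      rw [h1, map_add, map_smul, smul_eq_mul, hff, topL_succ _ _ _ _ (ff_monic _) (ff_natDegree _)]

lemma hsymm_eq (R : Type*) [CommRing R] (r k : ℕ) :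
    hsymm R r k = PowerSeries.coeff k (HH (fun i : Fin r => (X i : MvPolynomial (Fin r) R))) := by
  unfold _root_.hsymm HH
  rw [PowerSeries.coeff_prod]
  symm
  refine Finset.sum_bij (fun d _ => (d : Fin r → ℕ)) ?_ ?_ ?_ ?_
  · intro d hd
    rw [Finset.mem_finsuppAntidiag] at hd
    simp only [Finset.mem_filter, Fintype.mem_piFinset, Finset.mem_range]
    refine ⟨fun i => ?_, hd.1⟩
    have := Finset.single_le_sum (f := fun i => d i) (fun _ _ => Nat.zero_le _) (Finset.mem_univ i)
    have h2 := hd.1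
    rw [h2] at this
    omega
  · intro a _ b _ h
    exact DFunLike.coe_injective h
  · intro d hd
    simp only [Finset.mem_filter, Fintype.mem_piFinset, Finset.mem_range] at hd
    refine ⟨Finsupp.equivFunOnFinite.symm d, ?_, rfl⟩
    rw [Finset.mem_finsuppAntidiag]
    exact ⟨hd.2, by simp⟩
  · intro d _
    simp

lemma neg_one_pow_sq {S : Type*} [CommRing S] (k : ℕ) : ((-1) ^ k * (-1) ^ k : S) = 1 := by
  rw [← mul_pow]; simp

section main
variable (R : Type*) [CommRing R] (s : ℕ)

/-- shifted complete homogeneous polynomials -/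
noncomputable def GG (m : ℕ) : MvPolynomial (Fin (s + 1)) R :=
  topL (ff (fun i : Fin (s + 1) => (X i : MvPolynomial (Fin (s + 1)) R))) s (Polynomial.X ^ m)

lemma GG_mem [Nontrivial R] (n : ℕ) (c : R) (hn : s + 1 ≤ n) (m : ℕ) :
    GG R s (n + m) - C c * GG R s m ∈ IG R (s + 1) n c := by
  set f := ff (fun i : Fin (s + 1) => (X i : MvPolynomial (Fin (s + 1)) R)) with hf
  have hmon : f.Monic := ff_monic _
  have hh : ∀ k, GG R s (k + s) = hsymm R (s + 1) k := fun k => by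
    rw [hsymm_eq, ← topL_pow]; rfl
  have small : ∀ m ≤ s, GG R s (n + m) - C c * GG R s m ∈ IG R (s + 1) n c := by
    intro m hm
    have h0 : GG R s m = if m = s then 1 else 0 := topL_pow_lt _ m hm
    rw [h0]
    split_ifs with h
    · subst h
      rw [hh, mul_one]
      exact Ideal.subset_span (Or.inr rfl)
    · rw [mul_zero, sub_zero, show n + m = (n + m - s) + s by omega, hh]
      refine Ideal.subset_span (Or.inl ⟨_, ?_, rfl⟩)
      rw [Set.mem_Icc]; omega
  have key : ∀ p : Polynomial (MvPolynomial (Fin (s + 1)) R),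
      topL f s ((Polynomial.X ^ n - Polynomial.C (C c)) * p) ∈ IG R (s + 1) n c := by
    intro p
    have h1 : (Polynomial.X ^ n - Polynomial.C (C c)) * p =
        f * ((Polynomial.X ^ n - Polynomial.C (C c)) * (p /ₘ f)) +
        (Polynomial.X ^ n - Polynomial.C (C c)) * (p %ₘ f) := by
      conv_lhs => rw [← Polynomial.modByMonic_add_div p f]
      ring
    have h2 : (p %ₘ f).natDegree < s + 1 := by
      have := Polynomial.natDegree_modByMonic_lt p hmon (by
        intro h; have := ff_natDegree (fun i : Fin (s + 1) => (X i : MvPolynomial (Fin (s + 1)) R))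
        rw [← hf, h] at this; simp at this)
      rwa [hf, ff_natDegree] at this
    rw [h1, map_add, topL_mul _ _ _ hmon, zero_add, Polynomial.as_sum_range' _ _ h2,
      Finset.mul_sum, map_sum]
    refine Ideal.sum_mem _ fun i hi => ?_
    have h3 : (Polynomial.X ^ n - Polynomial.C (C c)) *
        Polynomial.monomial i ((p %ₘ f).coeff i) =
        (p %ₘ f).coeff i • (Polynomial.X ^ (n + i) - (C c : MvPolynomial (Fin (s + 1)) R) • Polynomial.X ^ i) := by
      rw [← Polynomial.C_mul_X_pow_eq_monomial, Polynomial.smul_eq_C_mul, Polynomial.smul_eq_C_mul]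
      ring
    rw [h3, map_smul, map_sub, map_smul, smul_eq_mul, smul_eq_mul]
    exact Ideal.mul_mem_left _ _ (small i (by rw [Finset.mem_range] at hi; omega))
  have := key (Polynomial.X ^ m)
  rw [show (Polynomial.X ^ n - Polynomial.C (C c : MvPolynomial (Fin (s + 1)) R)) * Polynomial.X ^ m =
    (Polynomial.X ^ (n + m) - (C c : MvPolynomial (Fin (s + 1)) R) • Polynomial.X ^ m) by
      rw [Polynomial.smul_eq_C_mul]; ring, map_sub, map_smul] at this
  exact this

/-- Jacobi–Trudi type matrix. -/
noncomputable def Hmat (d : Fin (s + 1) → ℕ) :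
    Matrix (Fin (s + 1)) (Fin (s + 1)) (MvPolynomial (Fin (s + 1)) R) :=
  Matrix.of fun l j => GG R s (d j + (l.rev : ℕ))

noncomputable def Emat :
    Matrix (Fin (s + 1)) (Fin (s + 1)) (MvPolynomial (Fin (s + 1)) R) :=
  Matrix.of fun i l => (∏ j ∈ Finset.univ.erase i,
    (Polynomial.X - Polynomial.C (X j : MvPolynomial (Fin (s + 1)) R))).coeff (l.rev : ℕ)

lemma pow_eq [Nontrivial R] (i : Fin (s + 1)) (a : ℕ) :
    (X i : MvPolynomial (Fin (s + 1)) R) ^ a = ∑ l, Emat R s i l * GG R s (a + (l.rev : ℕ)) := by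
  set f := ff (fun i : Fin (s + 1) => (X i : MvPolynomial (Fin (s + 1)) R)) with hf
  have hmon : f.Monic := ff_monic _
  set g := ∏ j ∈ Finset.univ.erase i,
    (Polynomial.X - Polynomial.C (X j : MvPolynomial (Fin (s + 1)) R)) with hg
  have hfg : f = (Polynomial.X - Polynomial.C (X i)) * g :=
    (Finset.mul_prod_erase _ _ (Finset.mem_univ i)).symm
  have hgm : g.Monic := Polynomial.monic_prod_of_monic _ _ fun i _ => Polynomial.monic_X_sub_C _
  have hgd : g.natDegree = s := by
    rw [hg, Polynomial.natDegree_prod_of_monic _ _ fun i _ => Polynomial.monic_X_sub_C _]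
    simp
  have h1 : topL f s (Polynomial.X ^ a * g) = X i ^ a := by
    obtain ⟨w, hw⟩ : (Polynomial.X - Polynomial.C (X i)) ∣
        (Polynomial.X ^ a - Polynomial.C (X i : MvPolynomial (Fin (s + 1)) R) ^ a) :=
      sub_dvd_pow_sub_pow _ _ _
    have : Polynomial.X ^ a * g = f * w + (X i : MvPolynomial (Fin (s + 1)) R) ^ a • g := by
      rw [hfg, Polynomial.smul_eq_C_mul, map_pow]
      linear_combination g * hw
    rw [this, map_add, topL_mul _ _ _ hmon, map_smul, topL_of_lt _ _ _ hmon]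
    · have : g.coeff s = 1 := by
        have h := hgm.coeff_natDegree
        rwa [hgd] at h
      rw [this]; simp
    · rw [Polynomial.degree_eq_natDegree hmon.ne_zero, Polynomial.degree_eq_natDegree hgm.ne_zero,
        hgd, hf, ff_natDegree]
      exact_mod_cast Nat.lt_succ_self s
  rw [← h1, Polynomial.as_sum_range' g (s + 1) (by omega), Finset.mul_sum, map_sum,
    Finset.sum_range, ← Equiv.sum_comp Fin.revPerm]
  refine Finset.sum_congr rfl fun l _ => ?_
  have : Polynomial.X ^ a * Polynomial.monomial (l.rev : ℕ) (g.coeff (l.rev : ℕ)) =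
      g.coeff (l.rev : ℕ) • Polynomial.X ^ (a + (l.rev : ℕ)) := by
    rw [← Polynomial.C_mul_X_pow_eq_monomial, Polynomial.smul_eq_C_mul]; ring
  rw [Fin.revPerm_apply, this, map_smul]
  rfl

lemma det_pow [Nontrivial R] (d : Fin (s + 1) → ℕ) :
    (Matrix.of fun i j => (X i : MvPolynomial (Fin (s + 1)) R) ^ d j).det =
      (Emat R s).det * (Hmat R s d).det := by
  rw [← Matrix.det_mul]
  congr 1
  ext1 i j
  rw [Matrix.of_apply, pow_eq, Matrix.mul_apply]
  rfl

lemma det_H0 [Nontrivial R] : (Hmat R s (fun j => (j : ℕ))).det = 1 := by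
  have hl : ∀ l j : Fin (s + 1), j ≤ l → Hmat R s (fun j => (j : ℕ)) l j = if j = l then 1 else 0 := by
    intro l j h
    have h' : (j : ℕ) ≤ l := h
    have := l.2
    have h2 := Fin.val_rev l
    have h1 := topL_pow_lt (fun i : Fin (s + 1) => (X i : MvPolynomial (Fin (s + 1)) R))
      ((j : ℕ) + (l.rev : ℕ)) (by omega)
    refine h1.trans ?_
    congr 1
    rw [Fin.ext_iff]
    apply propext
    omega
  rw [Matrix.det_of_isUpperTriangular]
  · refine Finset.prod_eq_one fun i _ => ?_
    rw [hl i i le_rfl]; simp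
  · intro i j h
    have h : j < i := h
    rw [hl i j h.le, if_neg h.ne]

noncomputable def TT : MvPolynomial (Fin (s + 1)) R →ₗ[R] MvPolynomial (Fin (s + 1)) R :=
  (basisMonomials (Fin (s + 1)) R).constr R fun d => (Hmat R s d).det

lemma TT_monomial (d : Fin (s + 1) →₀ ℕ) : TT R s (monomial d 1) = (Hmat R s d).det := by
  have := (basisMonomials (Fin (s + 1)) R).constr_basis R (fun d => (Hmat R s d).det) d
  rwa [coe_basisMonomials] at this

noncomputable def AA : MvPolynomial (Fin (s + 1)) R →ₗ[R] MvPolynomial (Fin (s + 1)) R :=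
  ∑ σ : Equiv.Perm (Fin (s + 1)), (Equiv.Perm.sign σ : ℤ) • (rename σ).toLinearMap

lemma AA_apply (p : MvPolynomial (Fin (s + 1)) R) :
    AA R s p = ∑ σ : Equiv.Perm (Fin (s + 1)), (Equiv.Perm.sign σ : ℤ) • rename σ p := by
  simp [AA]

lemma AA_eq [Nontrivial R] (p : MvPolynomial (Fin (s + 1)) R) :
    AA R s p = (Emat R s).det * TT R s p := by
  have : AA R s = (LinearMap.mulLeft R (Emat R s).det).comp (TT R s) := by
    refine (basisMonomials (Fin (s + 1)) R).ext fun d => ?_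
    rw [coe_basisMonomials]
    simp only [LinearMap.comp_apply, LinearMap.mulLeft_apply, TT_monomial]
    rw [← det_pow, Matrix.det_apply, AA_apply]
    refine Finset.sum_congr rfl fun σ _ => ?_
    rw [Units.smul_def]
    congr 1
    rw [monomial_eq, Finsupp.prod_fintype _ _ (by simp)]
    simp
  rw [this]; rfl

lemma TT_mem [Nontrivial R] (n : ℕ) (c : R) (hn : s + 1 ≤ n) (p : MvPolynomial (Fin (s + 1)) R)
    (hp : p ∈ IP R (s + 1) n c) : TT R s p ∈ IG R (s + 1) n c := by
  have key : ∀ (i : Fin (s + 1)) (d : Fin (s + 1) →₀ ℕ),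
      TT R s (monomial d 1 * (X i ^ n - C c)) ∈ IG R (s + 1) n c := by
    intro i d
    have h1 : (monomial d 1 * (X i ^ n - C c) : MvPolynomial (Fin (s + 1)) R) =
        monomial (d + Finsupp.single i n) 1 - c • monomial d 1 := by
      rw [X_pow_eq_monomial, mul_sub, monomial_mul, smul_eq_C_mul]; ring_nf
    rw [h1, map_sub, map_smul, TT_monomial, TT_monomial, ← Ideal.Quotient.eq_zero_iff_mem,
      map_sub, sub_eq_zero, smul_eq_C_mul, map_mul, RingHom.map_det, RingHom.map_det]
    set φ := Ideal.Quotient.mk (IG R (s + 1) n c)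
    have h2 : φ.mapMatrix (Hmat R s (d + Finsupp.single i n : Fin (s + 1) →₀ ℕ)) =
        (φ.mapMatrix (Hmat R s d)).updateCol i (φ (C c) • fun l => φ.mapMatrix (Hmat R s d) l i) := by
      ext l j
      rw [Matrix.updateCol_apply]
      split_ifs with h
      · subst h
        have := GG_mem R s n c hn (d j + (l.rev : ℕ))
        rw [← Ideal.Quotient.eq_zero_iff_mem, map_sub, sub_eq_zero, map_mul] at this
        simp only [RingHom.mapMatrix_apply, Matrix.map_apply, Hmat, Matrix.of_apply, Pi.smul_apply,
          smul_eq_mul, Finsupp.add_apply, Finsupp.single_eq_same]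
        rw [← this]
        congr 2
        ring
      · simp [Hmat, Finsupp.single_apply, Ne.symm h]
    rw [h2, Matrix.det_updateCol_smul]
    congr 2
    exact Matrix.updateCol_eq_self _ _
  have key2 : ∀ (i : Fin (s + 1)) (g : MvPolynomial (Fin (s + 1)) R),
      TT R s (g * (X i ^ n - C c)) ∈ IG R (s + 1) n c := by
    intro i g
    induction g using MvPolynomial.induction_on' with
    | monomial d a =>
      have : (monomial d a : MvPolynomial (Fin (s + 1)) R) = a • monomial d 1 := by
        rw [smul_monomial]; simp
      rw [this, smul_mul_assoc, map_smul, smul_eq_C_mul]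
      exact Ideal.mul_mem_left _ _ (key i d)
    | add p q hp hq =>
      rw [add_mul, map_add]
      exact Ideal.add_mem _ hp hq
  unfold IP at hp
  obtain ⟨g, rfl⟩ := (Ideal.mem_span_range_iff_exists_fun).1 hp
  rw [map_sum]
  exact Ideal.sum_mem _ fun i _ => key2 i (g i)

lemma vander_eq : ∃ k : ℕ, vander R (s + 1) = (-1) ^ k *
    (Matrix.vandermonde (fun i : Fin (s + 1) => (X i : MvPolynomial (Fin (s + 1)) R))).det := by
  refine ⟨(Finset.univ.filter (fun p : Fin (s + 1) × Fin (s + 1) => p.1 < p.2)).card, ?_⟩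
  have h : (∏ x ∈ Finset.univ.sigma fun i : Fin (s + 1) => Finset.Ioi i,
      (X x.snd - X x.fst : MvPolynomial (Fin (s + 1)) R)) =
      ∏ p ∈ Finset.univ.filter (fun p : Fin (s + 1) × Fin (s + 1) => p.1 < p.2),
        (X p.2 - X p.1 : MvPolynomial (Fin (s + 1)) R) := by
    refine Finset.prod_bij' (fun p _ => (p.1, p.2)) (fun p _ => ⟨p.1, p.2⟩) ?_ ?_ ?_ ?_ ?_ <;> simp
  rw [Matrix.det_vandermonde, vander, ← Finset.prod_const, Finset.prod_sigma', h,
    ← Finset.prod_mul_distrib]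
  refine Finset.prod_congr rfl fun p _ => by ring

lemma rename_vander (σ : Equiv.Perm (Fin (s + 1))) :
    rename σ (vander R (s + 1)) = (Equiv.Perm.sign σ : ℤ) • vander R (s + 1) := by
  obtain ⟨k, hk⟩ := vander_eq R s
  have : rename σ (Matrix.vandermonde
      (fun i : Fin (s + 1) => (X i : MvPolynomial (Fin (s + 1)) R))).det =
      (Equiv.Perm.sign σ : ℤ) • (Matrix.vandermonde
        (fun i : Fin (s + 1) => (X i : MvPolynomial (Fin (s + 1)) R))).det := by
    rw [AlgHom.map_det, zsmul_eq_mul, ← Matrix.det_permute]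
    congr 1
    ext1 i j
    simp [Matrix.vandermonde]
  rw [hk, map_mul, this]
  simp only [map_pow, map_neg, map_one, zsmul_eq_mul]
  ring

lemma AA_vander (P : MvPolynomial (Fin (s + 1)) R) (hP : P.IsSymmetric) :
    AA R s (P * vander R (s + 1)) = ((s + 1).factorial : ℕ) • (P * vander R (s + 1)) := by
  rw [AA_apply]
  have : ∀ σ : Equiv.Perm (Fin (s + 1)), (Equiv.Perm.sign σ : ℤ) • rename σ (P * vander R (s + 1))
      = P * vander R (s + 1) := by
    intro σ
    rw [map_mul, hP σ, rename_vander, mul_smul_comm, smul_smul]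
    rcases Int.units_eq_one_or (Equiv.Perm.sign σ) with h | h <;> simp [h]
  rw [Finset.sum_congr rfl fun σ _ => this σ, Finset.sum_const, Finset.card_univ,
    Fintype.card_perm, Fintype.card_fin]

lemma TT_vander [IsDomain R] (P : MvPolynomial (Fin (s + 1)) R) (hP : P.IsSymmetric) :
    ∃ k : ℕ, TT R s (P * vander R (s + 1)) = (-1) ^ k * ((s + 1).factorial : ℕ) • P := by
  obtain ⟨k, hk⟩ := vander_eq R s
  refine ⟨k, ?_⟩
  have hE : (Matrix.vandermonde
      (fun i : Fin (s + 1) => (X i : MvPolynomial (Fin (s + 1)) R))).det = (Emat R s).det := by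
    have := det_pow R s (fun j => (j : ℕ))
    rw [det_H0, mul_one] at this
    exact this
  have h0 : (Emat R s).det ≠ 0 := by
    rw [← hE, Matrix.det_vandermonde_ne_zero_iff]
    exact X_injective
  apply mul_left_cancel₀ h0
  rw [← AA_eq, AA_vander R s P hP, hk, hE]
  simp only [nsmul_eq_mul]
  ring

end main

/-- Injectivity of `θ̄ : QH*(G(r,n)) → QH*((ℙ^{n-1})^r)|_{e^{tᵢ}=(-1)^{r-1}e^t}` from
Section 2: working over `ℂ[q]` with `c = (-1)^{r-1} q`, if `P` is symmetric in
`x₁, …, x_r` and `P·Δ ∈ I_P(c) = ⟨x₁ⁿ - c, …, x_rⁿ - c⟩`, then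
`P ∈ I_G(c) = ⟨h_{n-r+1}, …, h_{n-1}, h_n - c⟩`. -/
theorem thetabar_injectivity (n r : ℕ) (hr : 1 ≤ r) (hrn : r ≤ n)
    (P : MvPolynomial (Fin r) (Polynomial ℂ)) (hP : P.IsSymmetric)
    (h : P * vander (Polynomial ℂ) r ∈
      IP (Polynomial ℂ) r n ((-1) ^ (r - 1) * Polynomial.X)) :
    P ∈ IG (Polynomial ℂ) r n ((-1) ^ (r - 1) * Polynomial.X) := by
  obtain ⟨s, rfl⟩ : ∃ s, r = s + 1 := ⟨r - 1, by omega⟩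
  obtain ⟨k, hk⟩ := TT_vander (Polynomial ℂ) s P hP
  have h1 := TT_mem (Polynomial ℂ) s n _ hrn _ h
  rw [hk] at h1
  have h2 := Ideal.mul_mem_left _
    ((-1) ^ k * C (Polynomial.C (((s + 1).factorial : ℂ)⁻¹))) h1
  convert h2 using 1
  have h3 : ((s + 1).factorial : ℂ) ≠ 0 := by exact_mod_cast Nat.factorial_ne_zero _
  have h4 : (C (Polynomial.C (((s + 1).factorial : ℂ)⁻¹)) : MvPolynomial (Fin (s + 1)) (Polynomial ℂ))
      * (((s + 1).factorial : ℕ) : MvPolynomial (Fin (s + 1)) (Polynomial ℂ)) = 1 := by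
    rw [← map_natCast (C : _ →+* MvPolynomial (Fin (s + 1)) (Polynomial ℂ)),
      ← map_natCast (Polynomial.C : ℂ →+* _), ← map_mul, ← map_mul, inv_mul_cancel₀ h3, map_one, map_one]
  have h5 : ((-1) ^ k * (-1) ^ k : MvPolynomial (Fin (s + 1)) (Polynomial ℂ)) = 1 := neg_one_pow_sq k
  rw [nsmul_eq_mul]
  linear_combination (-P) * h4 - (P * C (Polynomial.C (((s + 1).factorial : ℂ)⁻¹)) * (((s + 1).factorial : ℕ) : MvPolynomial (Fin (s + 1)) (Polynomial ℂ))) * h5
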